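/- (Weighted ε-Poincaré inequality) Let p > 1 and 3/2 < q < ∞. Then there is a constant C = C(p,q) such that for every nonnegative Schwartz function g : ℝ³ → [0,∞), every Schwartz function φ : ℝ³ → ℝ, and every ε > 0: ∫_{ℝ³} ⟨v⟩^{9/2} φ² g^{p+1} dv ≤ ε ∫_{ℝ³} ⟨v⟩^{3/2} |∇(φ g^{p/2})|² dv + C ( ε^{−3} ‖g‖_{L^q_{9/2}}^{2q} )^{1/(2q−3)} ∫_{ℝ³} ⟨v⟩^{9/2} φ² g^p dv. -/

import Mathlib

open MeasureTheory Real
noncomputable section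

/-- Velocity space `ℝ³`. -/
abbrev V3 : Type := EuclideanSpace ℝ (Fin 3)

/-- Japanese bracket `⟨v⟩ = (1 + |v|²)^{1/2}`. -/
def jap (v : V3) : ℝ := Real.sqrt (1 + ‖v‖ ^ 2)

/-- Positive part `x₊ = max(x,0)`. -/
def plus (x : ℝ) : ℝ := max x 0

/-- Partial derivative in the `i`-th coordinate direction. -/
def pd (i : Fin 3) (F : V3 → ℝ) (v : V3) : ℝ :=
  fderiv ℝ F v (EuclideanSpace.single i 1)

/-- The Landau-Coulomb diffusion matrix `A[g]`. -/
def Amat (g : V3 → ℝ) (v : V3) : Matrix (Fin 3) (Fin 3) ℝ := fun i j =>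
  ∫ w : V3, g w * (((if i = j then (1 : ℝ) else 0) -
      (v - w) i * (v - w) j / ‖v - w‖ ^ 2) / (8 * π * ‖v - w‖))

/-- The Coulomb potential `a[g]`. -/
def apot (g : V3 → ℝ) (v : V3) : ℝ := ∫ w : V3, g w / (4 * π * ‖v - w‖)

/-- Right-hand side `∇·(A[g]∇g − ∇a[g] g)` of the Landau equation. -/
def landauRHS (g : V3 → ℝ) (v : V3) : ℝ :=
  ∑ i : Fin 3, pd i (fun u =>
    (∑ j : Fin 3, Amat g u i j * pd j g u) - pd i (apot g) u * g u) v

/-- `f` solves the Landau equation pointwise at every time in `s`. -/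
def SolvesLandauOn (s : Set ℝ) (f : ℝ → V3 → ℝ) : Prop :=
  ∀ t ∈ s, ∀ v : V3, HasDerivAt (fun τ => f τ v) (landauRHS (f t) v) t

/-- A smooth, rapidly decaying (Schwartz-class in `v`) nonnegative solution on the
time set `s`, solving the equation pointwise on the interior of `s`. -/
structure SmoothRapidSolutionOn (s : Set ℝ) (f : ℝ → V3 → ℝ) : Prop where
  nonneg : ∀ t ∈ s, ∀ v : V3, 0 ≤ f t v
  smooth : ContDiffOn ℝ (⊤ : ℕ∞) (fun q : ℝ × V3 => f q.1 q.2) (s ×ˢ (Set.univ : Set V3))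
  schwartz : ∀ t ∈ s, ∃ φ : SchwartzMap V3 ℝ, ∀ v, f t v = φ v
  solves : SolvesLandauOn (interior s) f

/-- Normalization: unit mass, zero mean velocity, temperature `3`. -/
def Normalized (g : V3 → ℝ) : Prop :=
  (∫ v : V3, g v) = 1 ∧ (∀ i : Fin 3, (∫ v : V3, v i * g v) = 0) ∧
    (∫ v : V3, ‖v‖ ^ 2 * g v) = 3

/-- `c • Id ≤ M` as quadratic forms. -/
def matGE (c : ℝ) (M : Matrix (Fin 3) (Fin 3) ℝ) : Prop :=
  ∀ ξ : Fin 3 → ℝ, c * ∑ i, ξ i ^ 2 ≤ ∑ i, ∑ j, M i j * ξ i * ξ j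

/-- `M ≤ c • Id` as quadratic forms. -/
def matLE (M : Matrix (Fin 3) (Fin 3) ℝ) (c : ℝ) : Prop :=
  ∀ ξ : Fin 3 → ℝ, (∑ i, ∑ j, M i j * ξ i * ξ j) ≤ c * ∑ i, ξ i ^ 2

/-- `‖A[g]‖_{L^∞}`: sup over `v` of the operator norm of `A[g](v)`. -/
def AinfNorm (g : V3 → ℝ) : ℝ :=
  ⨆ v : V3, ‖Matrix.toEuclideanCLM (𝕜 := ℝ) (Amat g v)‖

/-- Fisher information (with the convention `x/0 = 0`). -/
def fisher (g : V3 → ℝ) : ℝ := ∫ v : V3, ‖gradient g v‖ ^ 2 / g v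

lemma one_add_pos (v : V3) : (0:ℝ) < 1 + ‖v‖ ^ 2 := by positivity

lemma jap_pos (v : V3) : 0 < jap v := Real.sqrt_pos.2 (one_add_pos v)

lemma jap_sq (v : V3) : jap v ^ 2 = 1 + ‖v‖ ^ 2 := Real.sq_sqrt (one_add_pos v).le

lemma one_le_jap (v : V3) : 1 ≤ jap v := by
  unfold jap
  rw [Real.one_le_sqrt]
  nlinarith [sq_nonneg ‖v‖]

lemma norm_le_jap (v : V3) : ‖v‖ ≤ jap v := by
  apply Real.le_sqrt_of_sq_le
  linarith

lemma jap_rpow (s : ℝ) (v : V3) : jap v ^ s = (1 + ‖v‖ ^ 2) ^ (s / 2) := by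
  unfold jap
  rw [Real.sqrt_eq_rpow, ← Real.rpow_mul (one_add_pos v).le]
  congr 1
  ring

lemma jap_rpow_pos (s : ℝ) (v : V3) : 0 < jap v ^ s := Real.rpow_pos_of_pos (jap_pos v) s

lemma jap_hasFDerivAt (s : ℝ) (v : V3) :
    HasFDerivAt (fun v : V3 => jap v ^ s) ((s * jap v ^ (s - 2)) • (innerSL ℝ v)) v := by
  have h1 : HasFDerivAt (fun v : V3 => 1 + ‖v‖ ^ 2) (2 • (innerSL ℝ v)) v :=
    (hasStrictFDerivAt_norm_sq v).hasFDerivAt.const_add 1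
  have h2 := h1.rpow_const (p := s / 2) (Or.inl (one_add_pos v).ne')
  simp_rw [← jap_rpow] at h2
  refine h2.congr_fderiv ?_
  have : (1 + ‖v‖ ^ 2) ^ (s / 2 - 1) = jap v ^ (s - 2) := by
    rw [jap_rpow]; congr 1; ring
  rw [this]
  ext w
  simp
  ring

lemma jap_contDiff (s : ℝ) {n : WithTop ℕ∞} : ContDiff ℝ n (fun v : V3 => jap v ^ s) := by
  simp_rw [jap_rpow]
  have : ContDiff ℝ n (fun v : V3 => 1 + ‖v‖ ^ 2) := contDiff_const.add (contDiff_norm_sq ℝ)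
  exact this.rpow_const_of_ne (fun v => (one_add_pos v).ne')

lemma jap_continuous (s : ℝ) : Continuous (fun v : V3 => jap v ^ s) :=
  (jap_contDiff (n := 0) s).continuous

lemma exists_weight {F : Type*} [NormedAddCommGroup F] [NormedSpace ℝ F]
    (s : ℝ) (φ : SchwartzMap V3 F) :
    ∃ ψ : SchwartzMap V3 F, ∀ v, ψ v = jap v ^ s • φ v := by
  refine ⟨SchwartzMap.smulLeftCLM F (fun v : V3 => jap v ^ s) φ, fun v => ?_⟩
  rw [SchwartzMap.smulLeftCLM_apply_apply]
  simp_rw [jap_rpow]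
  exact Function.hasTemperateGrowth_one_add_norm_sq_rpow _ _

lemma schwartz_bdd {F : Type*} [NormedAddCommGroup F] [NormedSpace ℝ F] (φ : SchwartzMap V3 F) :
    ∃ M, 0 < M ∧ ∀ v, ‖φ v‖ ≤ M := by
  obtain ⟨C, hC⟩ := φ.decay 0 0
  exact ⟨C, hC.1, fun v => by simpa using hC.2 v⟩

lemma integrable_of_schwartz {F : Type*} [NormedAddCommGroup F] [NormedSpace ℝ F]
    {f : V3 → ℝ} (hf : Continuous f) (s K : ℝ) (φ : SchwartzMap V3 F)
    (h : ∀ v, |f v| ≤ K * (jap v ^ s * ‖φ v‖)) : Integrable f := by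
  obtain ⟨ψ, hψ⟩ := exists_weight s φ
  refine ((ψ.integrable (μ := volume)).norm.const_mul K).mono' hf.aestronglyMeasurable
    (Filter.Eventually.of_forall fun v => ?_)
  rw [hψ, norm_smul, Real.norm_eq_abs, Real.norm_eq_abs,
    abs_of_pos (jap_rpow_pos s v)]
  exact h v

/-- second-order Taylor bound -/
lemma taylor2 (g : SchwartzMap V3 ℝ) :
    ∃ M, 0 < M ∧ ∀ v w : V3, |g (v + w) - g v - fderiv ℝ g v w| ≤ M * ‖w‖ ^ 2 := by
  obtain ⟨M, hM, hb⟩ := schwartz_bdd (SchwartzMap.fderivCLM ℝ V3 (V3 →L[ℝ] ℝ)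
    (SchwartzMap.fderivCLM ℝ V3 ℝ g))
  refine ⟨M, hM, fun v w => ?_⟩
  have hL : ∀ x y : V3, ‖fderiv ℝ g x - fderiv ℝ g y‖ ≤ M * ‖x - y‖ := by
    intro x y
    have := Convex.norm_image_sub_le_of_norm_fderiv_le (𝕜 := ℝ) (s := Set.univ)
      (f := SchwartzMap.fderivCLM ℝ V3 ℝ g) (C := M) (x := y) (y := x)
      (fun z _ => (SchwartzMap.fderivCLM ℝ V3 ℝ g).differentiableAt)
      (fun z _ => by simpa [SchwartzMap.fderivCLM_apply] using hb z) convex_univ trivial trivial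
    simpa [SchwartzMap.fderivCLM_apply] using this
  have := Convex.norm_image_sub_le_of_norm_fderiv_le' (𝕜 := ℝ) (s := Metric.closedBall v ‖w‖)
      (f := g) (C := M * ‖w‖) (φ := fderiv ℝ g v) (x := v) (y := v + w)
      (fun z _ => g.differentiableAt)
      (fun z hz => (hL z v).trans (by
        gcongr
        simpa [dist_eq_norm] using hz)) (convex_closedBall _ _)
        (by simp) (by simp)
  rw [Real.norm_eq_abs] at this
  simp only [add_sub_cancel_left] at this
  linarith [this]

lemma glaeser (g : SchwartzMap V3 ℝ) (hg : ∀ v, 0 ≤ g v) :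
    ∃ M, 0 < M ∧ ∀ v : V3, ‖fderiv ℝ g v‖ ≤ M * g v ^ ((1:ℝ)/2) := by
  obtain ⟨M, hM, hT⟩ := taylor2 g
  refine ⟨2 * √M, by positivity, fun v => ?_⟩
  have h0 := hg v
  refine ContinuousLinearMap.opNorm_le_bound _ (by positivity) fun w => ?_
  have hd : discrim (M * ‖w‖ ^ 2) (fderiv ℝ g v w) (g v) ≤ 0 := by
    apply discrim_le_zero
    intro t
    have h1 := (abs_le.1 (hT v (t • w))).2
    have h2 := hg (v + t • w)
    rw [map_smul, norm_smul, mul_pow, Real.norm_eq_abs, sq_abs, smul_eq_mul] at h1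
    nlinarith
  rw [discrim] at hd
  rw [Real.norm_eq_abs, ← Real.sqrt_eq_rpow]
  apply abs_le_of_sq_le_sq _ (by positivity)
  have e1 := Real.sq_sqrt hM.le
  have e2 := Real.sq_sqrt h0
  calc (fderiv ℝ g v w)^2 ≤ 4 * M * g v * ‖w‖ ^ 2 := by linarith
    _ = 4 * (√M)^2 * (√(g v))^2 * ‖w‖ ^ 2 := by rw [e1, e2]
    _ = _ := by ring

lemma rpow_hasFDerivAt (g : SchwartzMap V3 ℝ) (hg : ∀ v, 0 ≤ g v) {r : ℝ} (hr : 1 / 2 < r)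
    (v : V3) : HasFDerivAt (fun u => g u ^ r) ((r * g v ^ (r - 1)) • fderiv ℝ g v) v := by
  rcases (hg v).eq_or_lt with h | h
  · obtain ⟨M, hM, hT⟩ := taylor2 g
    obtain ⟨M', hM', hG⟩ := glaeser g hg
    have hz : fderiv ℝ g v = 0 := by
      have := hG v
      rw [← h, Real.zero_rpow (by norm_num), mul_zero] at this
      exact norm_le_zero_iff.1 this
    rw [hz, smul_zero]
    rw [hasFDerivAt_iff_isLittleO_nhds_zero]
    have h0 : g v ^ r = 0 := by rw [← h, Real.zero_rpow (by linarith)]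
    simp only [h0, sub_zero, zero_apply]
    have hb : ∀ w : V3, ‖g (v + w) ^ r‖ ≤ M ^ r * ‖‖w‖ ^ (2 * r)‖ := by
      intro w
      have h1 := (abs_le.1 (hT v w)).2
      rw [hz, ← h] at h1
      simp only [sub_zero, zero_apply] at h1
      have h2 := hg (v + w)
      rw [Real.norm_of_nonneg (by positivity), Real.norm_of_nonneg (by positivity),
        Real.rpow_mul (norm_nonneg _), ← Real.mul_rpow hM.le (by positivity)]
      apply Real.rpow_le_rpow h2 _ (by linarith)
      simpa using h1
    refine (Asymptotics.IsBigO.of_bound (M ^ r) (Filter.Eventually.of_forall hb)).trans_isLittleO ?_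
    have hc : Filter.Tendsto (fun w : V3 => ‖w‖ ^ (2 * r - 1)) (nhds 0) (nhds 0) := by
      have : Continuous (fun w : V3 => ‖w‖ ^ (2 * r - 1)) :=
        (continuous_norm).rpow_const (fun _ => Or.inr (by linarith))
      simpa [Real.zero_rpow (show 2 * r - 1 ≠ 0 by linarith)] using this.tendsto 0
    rw [← Asymptotics.isLittleO_norm_right]
    have h5 := ((Asymptotics.isLittleO_one_iff ℝ).2 hc).mul_isBigO
      (Asymptotics.isBigO_refl (fun w : V3 => ‖w‖) (nhds 0))
    simp only [one_mul] at h5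
    refine h5.congr_left fun w => ?_
    rw [← Real.rpow_add_one' (norm_nonneg _) (by linarith)]
    congr 1
    ring
  · have := (g.differentiableAt (x := v)).hasFDerivAt.rpow_const (p := r) (Or.inl h.ne')
    exact this

lemma rpow_contDiff (g : SchwartzMap V3 ℝ) (hg : ∀ v, 0 ≤ g v) {r : ℝ} (hr : 1 / 2 < r) :
    ContDiff ℝ 1 (fun u => g u ^ r) ∧ ∃ K, 0 < K ∧ ∀ v, ‖fderiv ℝ (fun u => g u ^ r) v‖ ≤ K := by
  obtain ⟨M, hM, hG⟩ := glaeser g hg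
  obtain ⟨B, hB, hgB⟩ := schwartz_bdd g
  have hfd : fderiv ℝ (fun u => g u ^ r) = fun v => (r * g v ^ (r - 1)) • fderiv ℝ g v :=
    funext fun v => (rpow_hasFDerivAt g hg hr v).fderiv
  have hbd : ∀ v, ‖(r * g v ^ (r - 1)) • fderiv ℝ g v‖ ≤ r * M * g v ^ (r - 1/2) := by
    intro v
    have h0 := hg v
    rw [norm_smul, Real.norm_of_nonneg (by positivity)]
    calc r * g v ^ (r - 1) * ‖fderiv ℝ g v‖ ≤ r * g v ^ (r - 1) * (M * g v ^ ((1:ℝ)/2)) := by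
          gcongr; exact hG v
      _ = r * M * (g v ^ (r - 1) * g v ^ ((1:ℝ)/2)) := by ring
      _ = r * M * g v ^ (r - 1/2) := by
          congr 1
          rw [← Real.rpow_add' h0 (by linarith)]
          congr 1; ring
  refine ⟨?_, r * M * B ^ (r - 1/2), by positivity, fun v => ?_⟩
  · rw [contDiff_one_iff_fderiv]
    refine ⟨fun v => (rpow_hasFDerivAt g hg hr v).differentiableAt, ?_⟩
    rw [hfd, continuous_iff_continuousAt]
    intro v
    have hfc : Continuous (fderiv ℝ g) := (SchwartzMap.fderivCLM ℝ V3 ℝ g).continuous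
    rcases (hg v).eq_or_lt with h | h
    · have hz : fderiv ℝ g v = 0 := by
        have := hG v
        rw [← h, Real.zero_rpow (by norm_num), mul_zero] at this
        exact norm_le_zero_iff.1 this
      unfold ContinuousAt
      simp only [hz, smul_zero]
      apply squeeze_zero_norm hbd
      have hc : Continuous (fun v => r * M * g v ^ (r - 1/2)) :=
        continuous_const.mul (g.continuous.rpow_const (fun _ => Or.inr (by linarith)))
      have := hc.tendsto v
      simpa [← h, Real.zero_rpow (show r - 2⁻¹ ≠ 0 by linarith)] using this
    · exact ((continuousAt_const.mul (g.continuous.continuousAt.rpow_const (Or.inl h.ne'))).smul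
        hfc.continuousAt)
  · rw [hfd]
    refine (hbd v).trans ?_
    have h0 := hg v
    have := hgB v
    rw [Real.norm_of_nonneg h0] at this
    have h3 : 0 ≤ r - 1/2 := by linarith
    have h4 : 0 ≤ r := by linarith
    gcongr

lemma sq_add_le (a b : ℝ) : (a + b) ^ 2 ≤ 2 * a ^ 2 + 2 * b ^ 2 := by
  nlinarith [sq_nonneg (a - b)]

lemma jap_fderiv_norm (s : ℝ) (v : V3) :
    ‖fderiv ℝ (fun v : V3 => jap v ^ s) v‖ ≤ |s| * jap v ^ (s - 1) := by
  rw [(jap_hasFDerivAt s v).fderiv, norm_smul, innerSL_apply_norm, norm_mul, Real.norm_eq_abs,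
    Real.norm_of_nonneg (jap_rpow_pos _ v).le, mul_assoc]
  gcongr
  calc jap v ^ (s - 2) * ‖v‖ ≤ jap v ^ (s - 2) * jap v := by
        gcongr
        · exact (jap_rpow_pos _ v).le
        · exact norm_le_jap v
    _ = jap v ^ (s - 1) := by
        rw [← Real.rpow_add_one (jap_pos v).ne']
        congr 1; ring

lemma ibp_euler {f : V3 → ℝ} (hf : ContDiff ℝ 1 f) (hc : HasCompactSupport f) :
    3 * ∫ v, f v = - ∫ v, fderiv ℝ f v v := by
  have hfd : Continuous (fderiv ℝ f) := hf.continuous_fderiv one_ne_zero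
  have hcd : HasCompactSupport (fderiv ℝ f) := hc.fderiv (𝕜 := ℝ)
  have key : ∀ i : Fin 3, ∫ v, f v = - ∫ v : V3, fderiv ℝ f v (EuclideanSpace.single i 1) * v i := by
    intro i
    have hp : ∀ x : V3, fderiv ℝ (fun v : V3 => v i) x (EuclideanSpace.single i 1) = 1 := by
      intro x
      have : (fun v : V3 => v i) = (EuclideanSpace.proj i : V3 →L[ℝ] ℝ) := rfl
      rw [this, ContinuousLinearMap.fderiv]
      simp
    have h1 : Continuous (fun x : V3 => fderiv ℝ f x (EuclideanSpace.single i 1) * x i) := by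
      fun_prop
    have := integral_mul_fderiv_eq_neg_fderiv_mul_of_integrable (μ := (volume : Measure V3))
      (f := f) (g := fun v : V3 => v i) (v := EuclideanSpace.single i 1)
      (h1.integrable_of_hasCompactSupport (by
        apply HasCompactSupport.mul_right
        exact hcd.comp_left (g := fun L : V3 →L[ℝ] ℝ => L (EuclideanSpace.single i 1)) (by simp)))
      (by
        simp_rw [hp, mul_one]
        exact hf.continuous.integrable_of_hasCompactSupport hc)
      (by
        apply Continuous.integrable_of_hasCompactSupport
        · have := hf.continuous
          fun_prop
        · exact hc.mul_right)
      (fun x _ => hf.differentiable one_ne_zero x)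
      (fun x _ => by fun_prop)
    simp_rw [hp, mul_one] at this
    exact this
  have hIntg : ∀ i : Fin 3, Integrable
      (fun v : V3 => fderiv ℝ f v (EuclideanSpace.single i 1) * v i) := by
    intro i
    apply Continuous.integrable_of_hasCompactSupport
    · fun_prop
    · apply HasCompactSupport.mul_right
      exact hcd.comp_left (g := fun L : V3 →L[ℝ] ℝ => L (EuclideanSpace.single i 1)) (by simp)
  have hs : ∀ v : V3, fderiv ℝ f v v = ∑ i, fderiv ℝ f v (EuclideanSpace.single i 1) * v i := by
    intro v
    have h2 := (EuclideanSpace.basisFun (Fin 3) ℝ).sum_repr v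
    conv_lhs => rw [← h2]
    rw [(EuclideanSpace.basisFun (Fin 3) ℝ).sum_repr v]
    conv_lhs => arg 2; rw [← h2]
    rw [map_sum]
    refine Finset.sum_congr rfl fun i _ => ?_
    rw [map_smul]
    simp [mul_comm]
  simp_rw [hs]
  rw [integral_finsetSum _ (fun i _ => hIntg i), Fin.sum_univ_three]
  linarith [key 0, key 1, key 2]

lemma hardy {F : V3 → ℝ} (hF : ContDiff ℝ 1 F) (hc : HasCompactSupport F) :
    ∫ v, jap v ^ (-(1:ℝ)/2) * F v ^ 2 ≤ ∫ v, jap v ^ ((3:ℝ)/2) * ‖fderiv ℝ F v‖ ^ 2 := by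
  have hFd : Continuous (fderiv ℝ F) := hF.continuous_fderiv one_ne_zero
  have hcd : HasCompactSupport (fderiv ℝ F) := hc.fderiv (𝕜 := ℝ)
  have hFc := hF.continuous
  set f : V3 → ℝ := fun v => jap v ^ (-(1:ℝ)/2) * F v ^ 2 with hfdef
  have hf : ContDiff ℝ 1 f := (jap_contDiff _).mul (hF.pow 2)
  have hF2 : HasCompactSupport (fun v => F v ^ 2) := hc.comp_left (g := fun x : ℝ => x ^ 2) (by simp)
  have hfc : HasCompactSupport f := hF2.mul_left
  have hD2 : HasCompactSupport (fun v => ‖fderiv ℝ F v‖ ^ 2) :=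
    hcd.comp_left (g := fun L : V3 →L[ℝ] ℝ => ‖L‖ ^ 2) (by simp)
  have hI1 : Integrable f := hf.continuous.integrable_of_hasCompactSupport hfc
  have hI2 : Integrable (fun v => jap v ^ ((3:ℝ)/2) * ‖fderiv ℝ F v‖ ^ 2) := by
    apply Continuous.integrable_of_hasCompactSupport
    · exact (jap_continuous _).mul (hFd.norm.pow 2)
    · exact hD2.mul_left
  have hE := ibp_euler hf hfc
  have hI3 : Integrable (fun v => fderiv ℝ f v v) := by
    apply Continuous.integrable_of_hasCompactSupport
    · have := hf.continuous_fderiv one_ne_zero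
      fun_prop
    · refine HasCompactSupport.mono' (hfc.fderiv (𝕜 := ℝ)) ?_
      refine Set.Subset.trans ?_ subset_closure
      intro v hv
      simp only [Function.mem_support, ne_eq] at hv ⊢
      intro h
      exact hv (by rw [h]; simp)
  have hpt : ∀ v, - fderiv ℝ f v v ≤ (3/2) * f v + jap v ^ ((3:ℝ)/2) * ‖fderiv ℝ F v‖ ^ 2 := by
    intro v
    have h1 := (jap_hasFDerivAt (-(1:ℝ)/2) v).mul ((hF.differentiable one_ne_zero v).hasFDerivAt.pow 2)
    have h2 : fderiv ℝ f v v = jap v ^ (-(1:ℝ)/2) * (2 * F v * fderiv ℝ F v v) +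
        F v ^ 2 * ((-(1:ℝ)/2) * jap v ^ (-(1:ℝ)/2-2) * ‖v‖ ^ 2) := by
      have h3 : fderiv ℝ f v = _ := h1.fderiv
      rw [h3]
      simp
    rw [h2]
    have hJ := jap_rpow_pos (-(1:ℝ)/2) v
    have hJ2 := jap_rpow_pos (-(1:ℝ)/2 - 2) v
    have e1 : jap v ^ (-(1:ℝ)/2) = jap v ^ (-(1:ℝ)/2 - 2) * jap v ^ 2 := by
      rw [← Real.rpow_natCast, ← Real.rpow_add (jap_pos v)]; norm_num
    have e2 : jap v ^ ((3:ℝ)/2) = jap v ^ (-(1:ℝ)/2) * jap v ^ 2 := by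
      rw [← Real.rpow_natCast, ← Real.rpow_add (jap_pos v)]; norm_num
    have e3 : jap v ^ (-(1:ℝ)/2 - 2) * ‖v‖ ^ 2 ≤ jap v ^ (-(1:ℝ)/2) := by
      rw [e1]; gcongr; exact norm_le_jap v
    have e4 : |fderiv ℝ F v v| ≤ ‖fderiv ℝ F v‖ * jap v :=
      ((fderiv ℝ F v).le_opNorm v).trans (by gcongr; exact norm_le_jap v)
    have e5 : (fderiv ℝ F v v) ^ 2 ≤ (‖fderiv ℝ F v‖ * jap v) ^ 2 := sq_le_sq' (by
      linarith [(abs_le.1 e4).1]) (abs_le.1 e4).2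
    have e6 : -(2 * F v * fderiv ℝ F v v) ≤ F v ^ 2 + (‖fderiv ℝ F v‖ * jap v) ^ 2 := by
      nlinarith [sq_nonneg (F v + fderiv ℝ F v v)]
    have e7 := mul_le_mul_of_nonneg_left e6 hJ.le
    have e8 := mul_le_mul_of_nonneg_left e3 (sq_nonneg (F v))
    rw [e2, hfdef]
    simp only
    nlinarith
  have hmono := integral_mono hI3.neg ((hI1.const_mul (3/2)).add hI2) hpt
  simp only [Pi.neg_apply, Pi.add_apply] at hmono
  rw [integral_neg, integral_add (hI1.const_mul (3/2)) hI2, integral_const_mul] at hmono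
  have h0 : 0 ≤ ∫ v, jap v ^ ((3:ℝ)/2) * ‖fderiv ℝ F v‖ ^ 2 :=
    integral_nonneg fun v => mul_nonneg (jap_rpow_pos _ v).le (by positivity)
  linarith

lemma sobolev : ∃ S : ℝ, 0 < S ∧ ∀ u : V3 → ℝ, ContDiff ℝ 1 u → HasCompactSupport u →
    ∫ v, u v ^ 6 ≤ S * (∫ v, ‖fderiv ℝ u v‖ ^ 2) ^ 3 := by
  set c : NNReal := eLpNormLESNormFDerivOfEqInnerConst (volume : Measure V3) (2:NNReal) with hcdef
  refine ⟨(c:ℝ) ^ 6 + 1, by positivity, fun u hu hc => ?_⟩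
  have h := eLpNorm_le_eLpNorm_fderiv_of_eq_inner (volume : Measure V3) hu hc
    (p := 2) (p' := 6) (by norm_num) (by simp) (by simp; norm_num)
  have hud : Continuous (fderiv ℝ u) := hu.continuous_fderiv one_ne_zero
  have hcd : HasCompactSupport (fderiv ℝ u) := hc.fderiv (𝕜 := ℝ)
  have m1 : MemLp u (6:NNReal) volume := hu.continuous.memLp_of_hasCompactSupport hc
  have m2 : MemLp (fderiv ℝ u) (2:NNReal) volume := hud.memLp_of_hasCompactSupport hcd
  rw [m1.eLpNorm_eq_integral_rpow_norm (by simp) (by simp),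
    m2.eLpNorm_eq_integral_rpow_norm (by simp) (by simp), ← hcdef] at h
  set A := ∫ v, u v ^ 6
  set B := ∫ v, ‖fderiv ℝ u v‖ ^ 2
  have hA : 0 ≤ A := integral_nonneg fun v => by positivity
  have hB : 0 ≤ B := integral_nonneg fun v => by positivity
  have eA : (∫ v, ‖u v‖ ^ ((6:NNReal) : ENNReal).toReal) = A := by
    apply integral_congr_ae
    refine Filter.Eventually.of_forall fun v => ?_
    have : ((6:NNReal) : ENNReal).toReal = ((6:ℕ):ℝ) := by simp
    simp only [this, Real.rpow_natCast, Real.norm_eq_abs]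
    exact Even.pow_abs (by decide) _
  have eB : (∫ v, ‖fderiv ℝ u v‖ ^ ((2:NNReal) : ENNReal).toReal) = B := by
    apply integral_congr_ae
    refine Filter.Eventually.of_forall fun v => ?_
    have : ((2:NNReal) : ENNReal).toReal = ((2:ℕ):ℝ) := by simp
    simp only [this, Real.rpow_natCast]
  rw [eA, eB, ← ENNReal.ofReal_coe_nnreal (p := c), ← ENNReal.ofReal_mul (NNReal.coe_nonneg c),
    ENNReal.ofReal_le_ofReal_iff (by positivity)] at h
  have h6 := pow_le_pow_left₀ (by positivity) h 6
  have t6 : ((6:NNReal) : ENNReal).toReal = ((6:ℕ):ℝ) := by simp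
  have t2 : ((2:NNReal) : ENNReal).toReal = ((2:ℕ):ℝ) := by simp
  rw [t6, t2, Real.rpow_inv_natCast_pow hA (by norm_num), mul_pow,
    show (B ^ ((2:ℕ):ℝ)⁻¹) ^ 6 = ((B ^ ((2:ℕ):ℝ)⁻¹) ^ 2) ^ 3 by ring,
    Real.rpow_inv_natCast_pow hB (by norm_num)] at h6
  have : 0 ≤ B ^ 3 := by positivity
  nlinarith

lemma wsobolev_c : ∃ S : ℝ, 0 < S ∧ ∀ F : V3 → ℝ, ContDiff ℝ 1 F → HasCompactSupport F →
    ∫ v, jap v ^ ((9:ℝ)/2) * F v ^ 6 ≤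
      S * (∫ v, jap v ^ ((3:ℝ)/2) * ‖fderiv ℝ F v‖ ^ 2) ^ 3 := by
  obtain ⟨S, hS, hSob⟩ := sobolev
  refine ⟨S * 64, by positivity, fun F hF hc => ?_⟩
  have hFd : Continuous (fderiv ℝ F) := hF.continuous_fderiv one_ne_zero
  have hcd : HasCompactSupport (fderiv ℝ F) := hc.fderiv (𝕜 := ℝ)
  set u : V3 → ℝ := fun v => jap v ^ ((3:ℝ)/4) * F v with hudef
  have hu : ContDiff ℝ 1 u := (jap_contDiff _).mul hF
  have huc : HasCompactSupport u := hc.mul_left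
  have h := hSob u hu huc
  have e1 : ∫ v, u v ^ 6 = ∫ v, jap v ^ ((9:ℝ)/2) * F v ^ 6 := by
    refine integral_congr_ae (Filter.Eventually.of_forall fun v => ?_)
    have hj : (jap v ^ ((3:ℝ)/4)) ^ 6 = jap v ^ ((9:ℝ)/2) := by
      rw [← Real.rpow_natCast (jap v ^ ((3:ℝ)/4)), ← Real.rpow_mul (jap_pos v).le]
      congr 1
      norm_num
    simp only [hudef, mul_pow, hj]
  have hF2 : HasCompactSupport (fun v => F v ^ 2) := hc.comp_left (g := fun x : ℝ => x ^ 2) (by simp)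
  have hD2 : HasCompactSupport (fun v => ‖fderiv ℝ F v‖ ^ 2) :=
    hcd.comp_left (g := fun L : V3 →L[ℝ] ℝ => ‖L‖ ^ 2) (by simp)
  have hI1 : Integrable (fun v => jap v ^ (-(1:ℝ)/2) * F v ^ 2) :=
    Continuous.integrable_of_hasCompactSupport
      ((jap_continuous _).mul (hF.continuous.pow 2)) hF2.mul_left
  have hI2 : Integrable (fun v => jap v ^ ((3:ℝ)/2) * ‖fderiv ℝ F v‖ ^ 2) :=
    Continuous.integrable_of_hasCompactSupport
      ((jap_continuous _).mul (hFd.norm.pow 2)) hD2.mul_left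
  have hI3 : Integrable (fun v => ‖fderiv ℝ u v‖ ^ 2) :=
    Continuous.integrable_of_hasCompactSupport ((hu.continuous_fderiv one_ne_zero).norm.pow 2)
      ((huc.fderiv (𝕜 := ℝ)).comp_left (g := fun L : V3 →L[ℝ] ℝ => ‖L‖ ^ 2) (by simp))
  have hpt : ∀ v, ‖fderiv ℝ u v‖ ^ 2 ≤ 2 * (jap v ^ ((3:ℝ)/2) * ‖fderiv ℝ F v‖ ^ 2) +
      2 * (jap v ^ (-(1:ℝ)/2) * F v ^ 2) := by
    intro v
    have hd : fderiv ℝ u v = _ := (((jap_contDiff (n := 1) ((3:ℝ)/4)).differentiable one_ne_zero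
      v).hasFDerivAt.mul (hF.differentiable one_ne_zero v).hasFDerivAt).fderiv
    have hJ := jap_rpow_pos ((3:ℝ)/4) v
    have hJ2 := jap_rpow_pos (-(1:ℝ)/4) v
    have hn : ‖fderiv ℝ u v‖ ≤ jap v ^ ((3:ℝ)/4) * ‖fderiv ℝ F v‖ + jap v ^ (-(1:ℝ)/4) * |F v| := by
      rw [hd]
      refine (norm_add_le _ _).trans ?_
      rw [norm_smul, norm_smul, Real.norm_of_nonneg hJ.le, Real.norm_eq_abs, mul_comm |F v|]
      gcongr
      refine (jap_fderiv_norm _ v).trans ?_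
      rw [show (3:ℝ)/4 - 1 = -1/4 by norm_num, show |(3:ℝ)/4| = 3/4 by norm_num [abs_of_pos]]
      linarith
    calc _ ≤ (jap v ^ ((3:ℝ)/4) * ‖fderiv ℝ F v‖ + jap v ^ (-(1:ℝ)/4) * |F v|) ^ 2 := by gcongr
      _ ≤ _ := sq_add_le _ _
      _ = _ := by
        rw [mul_pow, mul_pow, sq_abs, ← Real.rpow_natCast (jap v ^ ((3:ℝ)/4)),
          ← Real.rpow_natCast (jap v ^ (-(1:ℝ)/4)), ← Real.rpow_mul (jap_pos v).le,
          ← Real.rpow_mul (jap_pos v).le]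
        norm_num
  have hmono := integral_mono hI3 ((hI2.const_mul 2).add (hI1.const_mul 2)) hpt
  simp only [Pi.add_apply] at hmono
  rw [integral_add (hI2.const_mul 2) (hI1.const_mul 2), integral_const_mul,
    integral_const_mul] at hmono
  have hh := hardy hF hc
  rw [← e1]
  have h0 : 0 ≤ ∫ v, ‖fderiv ℝ u v‖ ^ 2 := integral_nonneg fun v => by positivity
  calc _ ≤ _ := h
    _ ≤ S * (4 * ∫ v, jap v ^ ((3:ℝ)/2) * ‖fderiv ℝ F v‖ ^ 2) ^ 3 := by
      gcongr
      linarith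
    _ = _ := by ring

lemma exists_cutoff : ∃ (χ : ℕ → V3 → ℝ) (K : ℝ), 0 ≤ K ∧
    (∀ n, ContDiff ℝ 1 (χ n)) ∧ (∀ n, HasCompactSupport (χ n)) ∧
    (∀ n v, 0 ≤ χ n v ∧ χ n v ≤ 1) ∧
    (∀ n v, ‖fderiv ℝ (χ n) v‖ ≤ K * ((n:ℝ) + 1)⁻¹) ∧
    ∀ v, Filter.Tendsto (fun n => χ n v) Filter.atTop (nhds 1) := by
  let b : ContDiffBump (0 : V3) := ⟨1, 2, one_pos, one_lt_two⟩
  have hb : ContDiff ℝ 1 b := b.contDiff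
  have hbc : HasCompactSupport b := b.hasCompactSupport
  obtain ⟨K, hK⟩ := (hbc.fderiv (𝕜 := ℝ)).exists_bound_of_continuous
    (hb.continuous_fderiv one_ne_zero)
  refine ⟨fun n v => b (((n:ℝ) + 1)⁻¹ • v), K, (norm_nonneg _).trans (hK 0), fun n => ?_,
    fun n => ?_, fun n v => ⟨b.nonneg, b.le_one⟩, fun n v => ?_, fun v => ?_⟩
  · exact hb.comp (contDiff_const_smul _)
  · exact hbc.comp_smul (by positivity)
  · have := fderiv_comp_smul (𝕜 := ℝ) (f := b) (x := v) (((n:ℝ) + 1)⁻¹)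
    rw [this, norm_smul, Real.norm_of_nonneg (by positivity), mul_comm]
    gcongr
    exact hK _
  · have h1 : Filter.Tendsto (fun n : ℕ => ((n:ℝ) + 1)⁻¹ • v) Filter.atTop (nhds 0) := by
      have := (tendsto_one_div_add_atTop_nhds_zero_nat (𝕜 := ℝ)).smul_const v
      simpa using this
    have h2 := (b.continuous.tendsto 0).comp h1
    have h3 : b 0 = 1 := b.one_of_mem_closedBall (by simp [b.rIn_pos.le])
    rw [h3] at h2
    exact h2

lemma wsobolev : ∃ S : ℝ, 0 < S ∧ ∀ F : V3 → ℝ, ContDiff ℝ 1 F →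
    Integrable (fun v => jap v ^ ((9:ℝ)/2) * F v ^ 6) →
    Integrable (fun v => jap v ^ ((3:ℝ)/2) * F v ^ 2) →
    Integrable (fun v => jap v ^ ((3:ℝ)/2) * ‖fderiv ℝ F v‖ ^ 2) →
    ∫ v, jap v ^ ((9:ℝ)/2) * F v ^ 6 ≤
      S * (∫ v, jap v ^ ((3:ℝ)/2) * ‖fderiv ℝ F v‖ ^ 2) ^ 3 := by
  obtain ⟨S, hS, hSob⟩ := wsobolev_c
  obtain ⟨χ, K, hK0, hχ, hχc, hχ1, hχd, hχt⟩ := exists_cutoff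
  refine ⟨S * 8, by positivity, fun F hF hI0 hI1 hI2 => ?_⟩
  set D := ∫ v, jap v ^ ((3:ℝ)/2) * ‖fderiv ℝ F v‖ ^ 2
  set E := ∫ v, jap v ^ ((3:ℝ)/2) * F v ^ 2
  have hn : ∀ n : ℕ, ∫ v, jap v ^ ((9:ℝ)/2) * (χ n v * F v) ^ 6 ≤
      S * (2 * D + 2 * (K * ((n:ℝ) + 1)⁻¹) ^ 2 * E) ^ 3 := by
    intro n
    have hc : HasCompactSupport (fun v => χ n v * F v) := (hχc n).mul_right
    have hC : ContDiff ℝ 1 (fun v => χ n v * F v) := (hχ n).mul hF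
    refine (hSob _ hC hc).trans ?_
    have h0 : 0 ≤ ∫ v, jap v ^ ((3:ℝ)/2) * ‖fderiv ℝ (fun v => χ n v * F v) v‖ ^ 2 :=
      integral_nonneg fun v => mul_nonneg (jap_rpow_pos _ v).le (by positivity)
    gcongr
    have hI3 : Integrable (fun v => jap v ^ ((3:ℝ)/2) * ‖fderiv ℝ (fun v => χ n v * F v) v‖ ^ 2) := by
      apply Continuous.integrable_of_hasCompactSupport
      · exact (jap_continuous _).mul ((hC.continuous_fderiv one_ne_zero).norm.pow 2)
      · apply HasCompactSupport.mul_left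
        exact (hc.fderiv (𝕜 := ℝ)).comp_left (g := fun L : V3 →L[ℝ] ℝ => ‖L‖ ^ 2) (by simp)
    have hpt : ∀ v, jap v ^ ((3:ℝ)/2) * ‖fderiv ℝ (fun v => χ n v * F v) v‖ ^ 2 ≤
        2 * (jap v ^ ((3:ℝ)/2) * ‖fderiv ℝ F v‖ ^ 2) +
        2 * (K * ((n:ℝ) + 1)⁻¹) ^ 2 * (jap v ^ ((3:ℝ)/2) * F v ^ 2) := by
      intro v
      have hd : fderiv ℝ (fun v => χ n v * F v) v = _ := (((hχ n).differentiable one_ne_zero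
        v).hasFDerivAt.mul (hF.differentiable one_ne_zero v).hasFDerivAt).fderiv
      have hJ := jap_rpow_pos ((3:ℝ)/2) v
      have hn : ‖fderiv ℝ (fun v => χ n v * F v) v‖ ≤
          ‖fderiv ℝ F v‖ + (K * ((n:ℝ) + 1)⁻¹) * |F v| := by
        rw [hd]
        refine (norm_add_le _ _).trans ?_
        rw [norm_smul, norm_smul, Real.norm_of_nonneg (hχ1 n v).1, Real.norm_eq_abs, mul_comm |F v|]
        gcongr
        · exact mul_le_of_le_one_left (norm_nonneg _) (hχ1 n v).2
        · exact hχd n v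
      calc _ ≤ jap v ^ ((3:ℝ)/2) * (‖fderiv ℝ F v‖ + (K * ((n:ℝ) + 1)⁻¹) * |F v|) ^ 2 := by gcongr
        _ ≤ jap v ^ ((3:ℝ)/2) * (2 * ‖fderiv ℝ F v‖ ^ 2 + 2 * ((K * ((n:ℝ) + 1)⁻¹) * |F v|) ^ 2) := by
          gcongr
          exact sq_add_le _ _
        _ = _ := by
          rw [mul_pow (K * ((n:ℝ) + 1)⁻¹) |F v|, sq_abs]
          ring
    have hmono := integral_mono hI3 ((hI2.const_mul 2).add
      (hI1.const_mul (2 * (K * ((n:ℝ) + 1)⁻¹) ^ 2))) hpt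
    simp only [Pi.add_apply] at hmono
    rw [integral_add (hI2.const_mul 2) (hI1.const_mul _), integral_const_mul,
      integral_const_mul] at hmono
    exact hmono
  have hL : Filter.Tendsto (fun n : ℕ => ∫ v, jap v ^ ((9:ℝ)/2) * (χ n v * F v) ^ 6) Filter.atTop
      (nhds (∫ v, jap v ^ ((9:ℝ)/2) * F v ^ 6)) := by
    apply tendsto_integral_of_dominated_convergence _ _ hI0
    · intro n
      refine Filter.Eventually.of_forall fun v => ?_
      have hJ := jap_rpow_pos ((9:ℝ)/2) v
      have h6 : 0 ≤ F v ^ 6 := by positivity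
      rw [Real.norm_of_nonneg (by positivity), mul_pow]
      gcongr
      exact mul_le_of_le_one_left h6 (pow_le_one₀ (hχ1 n v).1 (hχ1 n v).2)
    · refine Filter.Eventually.of_forall fun v => ?_
      have := (((hχt v).mul_const (F v)).pow 6).const_mul (jap v ^ ((9:ℝ)/2))
      simpa using this
    · intro n
      exact ((jap_continuous _).mul (((hχ n).continuous.mul hF.continuous).pow 6)).aestronglyMeasurable
  have hR : Filter.Tendsto (fun n : ℕ => S * (2 * D + 2 * (K * ((n:ℝ) + 1)⁻¹) ^ 2 * E) ^ 3)
      Filter.atTop (nhds (S * (2 * D + 2 * (K * 0) ^ 2 * E) ^ 3)) := by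
    have h1 : Filter.Tendsto (fun n : ℕ => ((n:ℝ) + 1)⁻¹) Filter.atTop (nhds 0) := by
      simpa using tendsto_one_div_add_atTop_nhds_zero_nat (𝕜 := ℝ)
    exact ((((((h1.const_mul K).pow 2).const_mul 2).mul_const E).const_add _).pow 3).const_mul S
  have := le_of_tendsto_of_tendsto' hL hR hn
  refine this.trans (le_of_eq ?_)
  ring

lemma holder3 {f1 f2 f3 : V3 → ℝ} (h1 : Integrable f1) (h2 : Integrable f2) (h3 : Integrable f3)
    (p1 : ∀ v, 0 ≤ f1 v) (p2 : ∀ v, 0 ≤ f2 v) (p3 : ∀ v, 0 ≤ f3 v) {a b c : ℝ}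
    (ha : 0 ≤ a) (hb : 0 ≤ b) (hc : 0 ≤ c) (habc : a + b + c = 1) :
    ∫ v, f1 v ^ a * f2 v ^ b * f3 v ^ c ≤ (∫ v, f1 v) ^ a * (∫ v, f2 v) ^ b * (∫ v, f3 v) ^ c := by
  have key := ENNReal.lintegral_prod_norm_pow_le (μ := (volume : Measure V3)) (Finset.univ : Finset (Fin 3))
    (f := ![fun v => ENNReal.ofReal (f1 v), fun v => ENNReal.ofReal (f2 v),
      fun v => ENNReal.ofReal (f3 v)]) (p := ![a, b, c])
    (by
      intro i _
      fin_cases i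
      · exact h1.aemeasurable.ennreal_ofReal
      · exact h2.aemeasurable.ennreal_ofReal
      · exact h3.aemeasurable.ennreal_ofReal)
    (by simpa [Fin.sum_univ_three] using habc)
    (by
      intro i _
      fin_cases i
      · exact ha
      · exact hb
      · exact hc)
  simp only [Fin.prod_univ_three, Matrix.cons_val_zero, Matrix.cons_val_one, Matrix.cons_val] at key
  rw [← ofReal_integral_eq_lintegral_ofReal h1 (Filter.Eventually.of_forall p1),
    ← ofReal_integral_eq_lintegral_ofReal h2 (Filter.Eventually.of_forall p2),
    ← ofReal_integral_eq_lintegral_ofReal h3 (Filter.Eventually.of_forall p3)] at key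
  have i1 : 0 ≤ ∫ v, f1 v := integral_nonneg p1
  have i2 : 0 ≤ ∫ v, f2 v := integral_nonneg p2
  have i3 : 0 ≤ ∫ v, f3 v := integral_nonneg p3
  rw [ENNReal.ofReal_rpow_of_nonneg i1 ha, ENNReal.ofReal_rpow_of_nonneg i2 hb,
    ENNReal.ofReal_rpow_of_nonneg i3 hc, ← ENNReal.ofReal_mul (by positivity),
    ← ENNReal.ofReal_mul (by positivity)] at key
  have e : ∀ v, ENNReal.ofReal (f1 v) ^ a * ENNReal.ofReal (f2 v) ^ b * ENNReal.ofReal (f3 v) ^ c =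
      ENNReal.ofReal (f1 v ^ a * f2 v ^ b * f3 v ^ c) := by
    intro v
    have := p1 v
    have := p2 v
    have := p3 v
    rw [ENNReal.ofReal_rpow_of_nonneg (p1 v) ha, ENNReal.ofReal_rpow_of_nonneg (p2 v) hb,
      ENNReal.ofReal_rpow_of_nonneg (p3 v) hc, ← ENNReal.ofReal_mul (by positivity),
      ← ENNReal.ofReal_mul (by positivity)]
  simp_rw [e] at key
  rw [integral_eq_lintegral_of_nonneg_ae]
  · refine (ENNReal.toReal_mono ENNReal.ofReal_ne_top key).trans ?_
    rw [ENNReal.toReal_ofReal (by positivity)]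
  · refine Filter.Eventually.of_forall fun v => ?_
    have := p1 v
    have := p2 v
    have := p3 v
    simp only [Pi.zero_apply]
    positivity
  · have m1 := h1.aemeasurable.pow_const a
    have m2 := h2.aemeasurable.pow_const b
    have m3 := h3.aemeasurable.pow_const c
    exact ((m1.mul m2).mul m3).aestronglyMeasurable

/-- final Young step -/
lemma young_step {q S T D X ε : ℝ} (hq : 3/2 < q) (hS : 0 < S) (hT : 0 ≤ T) (hD : 0 ≤ D)
    (hX : 0 ≤ X) (hε : 0 < ε) :
    T ^ (1/q) * X ^ (1 - 3/(2*q)) * (S * D ^ 3) ^ (1/(2*q)) ≤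
      ε * D + S ^ (1/(2*q-3)) * (ε ^ (-(3:ℝ)) * (T ^ (1/q)) ^ (2*q)) ^ (1/(2*q-3)) * X := by
  have hq0 : 0 < q := by linarith
  have hq3 : 0 < 2 * q - 3 := by linarith
  set θ := 3/(2*q) with hθ
  have hθ0 : 0 < θ := by positivity
  have hθ1 : 0 < 1 - θ := by
    rw [hθ, sub_pos, div_lt_one (by positivity)]; linarith
  set K := S ^ (1/(2*q-3)) * (ε ^ (-(3:ℝ)) * (T ^ (1/q)) ^ (2*q)) ^ (1/(2*q-3)) with hK
  have hK0 : 0 ≤ K := by positivity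
  have hy := Real.geom_mean_le_arith_mean2_weighted hθ0.le hθ1.le (mul_nonneg hε.le hD)
    (mul_nonneg hK0 hX) (by ring)
  have e0 : 1/(2*q-3) * (1 - θ) = 1/(2*q) := by
    rw [hθ]; field_simp
  have eK : K ^ (1 - θ) = S ^ (1/(2*q)) * (ε ^ (-θ) * T ^ (1/q)) := by
    rw [hK, Real.mul_rpow (by positivity) (by positivity), ← Real.rpow_mul hS.le, e0,
      ← Real.rpow_mul (by positivity), e0, Real.mul_rpow (by positivity) (by positivity),
      ← Real.rpow_mul hε.le, ← Real.rpow_mul (by positivity)]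
    congr 2
    · congr 1; rw [hθ]; ring
    · rw [mul_one_div_cancel (by positivity), Real.rpow_one]
  have eD : (D ^ 3) ^ (1/(2*q)) = D ^ θ := by
    rw [← Real.rpow_natCast, ← Real.rpow_mul hD]
    congr 1; rw [hθ]; push_cast; ring
  have eε : ε ^ θ * ε ^ (-θ) = 1 := by
    rw [← Real.rpow_add hε]; simp
  calc _ = (ε * D) ^ θ * (K * X) ^ (1 - θ) := by
        rw [Real.mul_rpow hε.le hD, Real.mul_rpow hK0 hX, eK, Real.mul_rpow hS.le (by positivity), eD]
        linear_combination (- T ^ (1/q) * X ^ (1-θ) * S ^ (1/(2*q)) * D ^ θ) * eε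
    _ ≤ θ * (ε * D) + (1 - θ) * (K * X) := hy
    _ ≤ ε * D + K * X := by
      have := mul_nonneg hε.le hD
      have := mul_nonneg hK0 hX
      nlinarith

/-- weighted ε-Poincaré inequality. -/
theorem weighted_eps_poincare
    (p q : ℝ) (hp : 1 < p) (hq : 3 / 2 < q) :
    ∃ C : ℝ, 0 < C ∧
      ∀ g φ : SchwartzMap V3 ℝ, (∀ v, 0 ≤ g v) → ∀ ε : ℝ, 0 < ε →
        (∫ v : V3, jap v ^ ((9 : ℝ) / 2) * φ v ^ 2 * g v ^ (p + 1)) ≤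
          ε * (∫ v : V3, jap v ^ ((3 : ℝ) / 2) *
              ‖gradient (fun u => φ u * g u ^ (p / 2)) v‖ ^ 2) +
          C * (ε ^ (-(3 : ℝ)) *
              ((∫ v : V3, g v ^ q * jap v ^ ((9 : ℝ) / 2)) ^ (1 / q)) ^ (2 * q)) ^
                (1 / (2 * q - 3)) *
            (∫ v : V3, jap v ^ ((9 : ℝ) / 2) * φ v ^ 2 * g v ^ p) := by
  obtain ⟨S, hS, hSob⟩ := wsobolev
  refine ⟨S ^ (1/(2*q-3)), by positivity, fun g φ hg ε hε => ?_⟩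
  have hq0 : 0 < q := by linarith
  obtain ⟨hG, K, hK, hGd⟩ := rpow_contDiff g hg (r := p/2) (by linarith)
  obtain ⟨B, hB, hgB⟩ := schwartz_bdd g
  obtain ⟨A, hA, hφA⟩ := schwartz_bdd φ
  set F : V3 → ℝ := fun u => φ u * g u ^ (p/2) with hFdef
  have hF : ContDiff ℝ 1 F := (φ.smooth 1).mul hG
  have hFd : Continuous (fderiv ℝ F) := hF.continuous_fderiv one_ne_zero
  have hgB' : ∀ v, g v ≤ B := fun v => by
    have := hgB v
    rwa [Real.norm_of_nonneg (hg v)] at this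
  set R := B ^ (p/2) with hR
  have hR0 : 0 < R := by positivity
  have hgR : ∀ v, g v ^ (p/2) ≤ R := fun v =>
    Real.rpow_le_rpow (hg v) (hgB' v) (by linarith)
  have hgr0 : ∀ v, 0 ≤ g v ^ (p/2) := fun v => Real.rpow_nonneg (hg v) _
  have hFb : ∀ v, |F v| ≤ R * ‖φ v‖ := by
    intro v
    rw [hFdef]
    simp only [abs_mul, abs_of_nonneg (hgr0 v), Real.norm_eq_abs]
    rw [mul_comm]
    gcongr
    exact hgR v
  have hFb2 : ∀ v, |F v| ≤ R * A := fun v => (hFb v).trans (by gcongr; exact hφA v)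
  have hIF : ∀ (s : ℝ) (k : ℕ), Integrable (fun v => jap v ^ s * F v ^ (k+1)) := by
    intro s k
    apply integrable_of_schwartz ((jap_continuous _).mul (hF.continuous.pow _)) s ((R * A)^k * R) φ
    intro v
    have hJ := jap_rpow_pos s v
    simp only [Pi.mul_apply, Pi.pow_apply]
    rw [abs_mul, abs_of_pos hJ, abs_pow, pow_succ]
    calc jap v ^ s * (|F v| ^ k * |F v|) ≤ jap v ^ s * ((R * A) ^ k * (R * ‖φ v‖)) := by
          gcongr
          · exact hFb2 v
          · exact hFb v
      _ = _ := by ring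
  have hI6 := hIF ((9:ℝ)/2) 5
  have hI2 := hIF ((9:ℝ)/2) 1
  have hI2' := hIF ((3:ℝ)/2) 1
  norm_num only at hI6 hI2 hI2'
  have hID : Integrable (fun v => jap v ^ ((3:ℝ)/2) * ‖fderiv ℝ F v‖ ^ 2) := by
    obtain ⟨A', hA', hφA'⟩ := schwartz_bdd (SchwartzMap.fderivCLM ℝ V3 ℝ φ)
    have j1 : Integrable (fun v => jap v ^ ((3:ℝ)/2) * φ v ^ 2) := by
      apply integrable_of_schwartz ((jap_continuous _).mul (φ.continuous.pow _)) ((3:ℝ)/2) A φ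
      intro v
      have hJ := jap_rpow_pos ((3:ℝ)/2) v
      simp only [Pi.mul_apply, Pi.pow_apply]
      rw [abs_mul, abs_of_pos hJ, abs_pow, ← Real.norm_eq_abs, pow_two]
      calc jap v ^ ((3:ℝ)/2) * (‖φ v‖ * ‖φ v‖) ≤ jap v ^ ((3:ℝ)/2) * (A * ‖φ v‖) := by
            gcongr
            exact hφA v
        _ = _ := by ring
    have j2 : Integrable (fun v => jap v ^ ((3:ℝ)/2) * ‖SchwartzMap.fderivCLM ℝ V3 ℝ φ v‖ ^ 2) := by
      apply integrable_of_schwartz ((jap_continuous _).mul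
        ((SchwartzMap.fderivCLM ℝ V3 ℝ φ).continuous.norm.pow _)) ((3:ℝ)/2) A'
        (SchwartzMap.fderivCLM ℝ V3 ℝ φ)
      intro v
      have hJ := jap_rpow_pos ((3:ℝ)/2) v
      simp only [Pi.mul_apply, Pi.pow_apply]
      rw [abs_mul, abs_of_pos hJ, abs_pow, abs_norm, pow_two]
      set y := ‖SchwartzMap.fderivCLM ℝ V3 ℝ φ v‖
      calc jap v ^ ((3:ℝ)/2) * (y * y) ≤ jap v ^ ((3:ℝ)/2) * (A' * y) := by
            gcongr
            exact hφA' v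
        _ = _ := by ring
    refine ((j1.const_mul (2 * K ^ 2)).add (j2.const_mul (2 * R ^ 2))).mono'
      ((jap_continuous _).mul (hFd.norm.pow 2)).aestronglyMeasurable
      (Filter.Eventually.of_forall fun v => ?_)
    have hJ := jap_rpow_pos ((3:ℝ)/2) v
    simp only [Pi.add_apply, SchwartzMap.fderivCLM_apply]
    rw [Real.norm_of_nonneg (by positivity)]
    have hd : fderiv ℝ F v = _ := ((φ.differentiableAt (x := v)).hasFDerivAt.mul
      (hG.differentiable one_ne_zero v).hasFDerivAt).fderiv
    have hn : ‖fderiv ℝ F v‖ ≤ |φ v| * K + R * ‖fderiv ℝ φ v‖ := by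
      rw [hd]
      refine (norm_add_le _ _).trans ?_
      rw [norm_smul, norm_smul, Real.norm_of_nonneg (hgr0 v), Real.norm_eq_abs]
      gcongr
      · exact hGd v
      · exact hgR v
    calc _ ≤ jap v ^ ((3:ℝ)/2) * (|φ v| * K + R * ‖fderiv ℝ φ v‖) ^ 2 := by gcongr
      _ ≤ jap v ^ ((3:ℝ)/2) * (2 * (|φ v| * K) ^ 2 + 2 * (R * ‖fderiv ℝ φ v‖) ^ 2) := by
        gcongr
        exact sq_add_le _ _
      _ = _ := by rw [mul_pow |φ v|, sq_abs]; ring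
  have hIg : Integrable (fun v => g v ^ q * jap v ^ ((9:ℝ)/2)) := by
    apply integrable_of_schwartz ((g.continuous.rpow_const (fun _ => Or.inr hq0.le)).mul
      (jap_continuous _)) ((9:ℝ)/2) (B ^ (q - 1)) g
    intro v
    have hJ := jap_rpow_pos ((9:ℝ)/2) v
    have h0 := hg v
    simp only [Pi.mul_apply]
    rw [abs_of_nonneg (by positivity), Real.norm_of_nonneg h0]
    have : g v ^ q = g v ^ (q - 1) * g v := by
      rw [← Real.rpow_add_one' h0 (by linarith)]; congr 1; ring
    rw [this]
    calc g v ^ (q - 1) * g v * jap v ^ ((9:ℝ)/2) ≤ B ^ (q - 1) * g v * jap v ^ ((9:ℝ)/2) := by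
          have : 0 ≤ q - 1 := by linarith
          gcongr
          exact hgB' v
      _ = _ := by ring
  have hsob := hSob F hF hI6 hI2' hID
  have hF2 : ∀ v, F v ^ 2 = φ v ^ 2 * g v ^ p := by
    intro v
    rw [hFdef]
    simp only [mul_pow]
    rw [← Real.rpow_natCast (g v ^ (p/2)), ← Real.rpow_mul (hg v)]
    congr 2
    push_cast; ring
  have hgrad : ∀ v, ‖gradient F v‖ = ‖fderiv ℝ F v‖ := by
    intro v
    simp [gradient]
  have hθ1 : 0 < 1 - 3/(2*q) := by
    rw [sub_pos, div_lt_one (by positivity)]; linarith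
  have hpt : ∀ v, jap v ^ ((9:ℝ)/2) * φ v ^ 2 * g v ^ (p+1) =
      (g v ^ q * jap v ^ ((9:ℝ)/2)) ^ (1/q) * (jap v ^ ((9:ℝ)/2) * F v ^ 2) ^ (1 - 3/(2*q)) *
        (jap v ^ ((9:ℝ)/2) * F v ^ 6) ^ (1/(2*q)) := by
    intro v
    have h0 := hg v
    have hJ := jap_rpow_pos ((9:ℝ)/2) v
    set w := jap v ^ ((9:ℝ)/2)
    have e1 : g v ^ (p+1) = g v ^ p * g v := Real.rpow_add_one' h0 (by linarith)
    set x := F v ^ 2 with hx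
    have hx0 : 0 ≤ x := by positivity
    have e2 : F v ^ 6 = x ^ (3:ℝ) := by
      rw [show (3:ℝ) = ((3:ℕ):ℝ) by norm_num, Real.rpow_natCast, hx]; ring
    rw [e2, Real.mul_rpow (by positivity) hJ.le, Real.mul_rpow hJ.le hx0,
      Real.mul_rpow hJ.le (by positivity), ← Real.rpow_mul h0, ← Real.rpow_mul hx0,
      mul_one_div_cancel hq0.ne', Real.rpow_one]
    have ew : w ^ (1/q) * w ^ (1 - 3/(2*q)) * w ^ (1/(2*q)) = w := by
      rw [← Real.rpow_add hJ, ← Real.rpow_add hJ]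
      conv_rhs => rw [← Real.rpow_one w]
      congr 1; field_simp; ring
    have ex : x ^ (1 - 3/(2*q)) * x ^ (3 * (1/(2*q))) = x := by
      have hs : 1 - 3/(2*q) + 3 * (1/(2*q)) = 1 := by ring
      rw [← Real.rpow_add' hx0 (by rw [hs]; norm_num), hs, Real.rpow_one]
    have ex2 : x = φ v ^ 2 * g v ^ p := hF2 v
    calc w * φ v ^ 2 * g v ^ (p+1) = w * x * g v := by rw [e1, ex2]; ring
      _ = (w ^ (1/q) * w ^ (1 - 3/(2*q)) * w ^ (1/(2*q))) *
          (x ^ (1 - 3/(2*q)) * x ^ (3 * (1/(2*q)))) * g v := by rw [ew, ex]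
      _ = _ := by ring
  have hH := holder3 hIg hI2 hI6
    (fun v => mul_nonneg (Real.rpow_nonneg (hg v) _) (jap_rpow_pos _ v).le)
    (fun v => mul_nonneg (jap_rpow_pos _ v).le (by positivity))
    (fun v => mul_nonneg (jap_rpow_pos _ v).le (by positivity))
    (a := 1/q) (b := 1 - 3/(2*q)) (c := 1/(2*q)) (by positivity) hθ1.le (by positivity)
    (by field_simp; ring)
  have hT0 : 0 ≤ ∫ v, g v ^ q * jap v ^ ((9:ℝ)/2) :=
    integral_nonneg fun v => mul_nonneg (Real.rpow_nonneg (hg v) _) (jap_rpow_pos _ v).le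
  have hD0 : 0 ≤ ∫ v, jap v ^ ((3:ℝ)/2) * ‖fderiv ℝ F v‖ ^ 2 :=
    integral_nonneg fun v => mul_nonneg (jap_rpow_pos _ v).le (by positivity)
  have hX0 : 0 ≤ ∫ v, jap v ^ ((9:ℝ)/2) * F v ^ 2 :=
    integral_nonneg fun v => mul_nonneg (jap_rpow_pos _ v).le (by positivity)
  have hY0 : 0 ≤ ∫ v, jap v ^ ((9:ℝ)/2) * F v ^ 6 :=
    integral_nonneg fun v => mul_nonneg (jap_rpow_pos _ v).le (by positivity)
  simp_rw [hpt, hgrad, mul_assoc (jap _ ^ ((9:ℝ)/2)), ← hF2]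
  refine hH.trans (le_trans ?_ (young_step hq hS hT0 hD0 hX0 hε))
  gcongr
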